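/- arXiv:1702.00320 — 3 statements merged into one kernel-verified Lean document; each statement's English description precedes it below -/
import Mathlib

section
/- Let A be a finite alphabet with |A| ≥ 2, let r and n be positive integers, let γ ∈ A^r, and for 0 ≤ i ≤ n let N(γ,i,n) = |{w ∈ A^n : occ(w,γ) = i}|. Then for every real ε with 6/⌊n/r⌋ ≤ ε ≤ 1/|A|^r, Σ_{0 ≤ i ≤ n/|A|^r − εn} N(γ,i,n) + Σ_{n/|A|^r + εn ≤ i ≤ n} N(γ,i,n) < 2·|A|^{n+2r−2}·r·e^{−|A|^r ε² n/(6r)}. -/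
open Filter Topology

namespace FSI

variable {A B D Q : Type*}

/-- The prefix of length `n` of the infinite word `x`. -/
def pref (x : ℕ → A) (n : ℕ) : List A := (List.range n).map x

/-- Number of (possibly overlapping) occurrences of `u` in `w`. -/
noncomputable def occ (w u : List A) : ℕ :=
  Nat.card {i : ℕ | i + u.length ≤ w.length ∧ (w.drop i).take u.length = u}

/-- Number of aligned occurrences of `u` in `w`. -/
noncomputable def alocc (w u : List A) : ℕ :=
  Nat.card {i : ℕ | i + u.length ≤ w.length ∧ i % u.length = 0 ∧ (w.drop i).take u.length = u}

/-- `x` is simply normal to word length `ℓ`. -/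
def SimplyNormalTo [Fintype A] (x : ℕ → A) (ℓ : ℕ) : Prop :=
  ∀ u : List A, u.length = ℓ →
    Tendsto (fun n : ℕ => (alocc (pref x (n * ℓ)) u : ℝ) / n) atTop
      (nhds ((Fintype.card A : ℝ)⁻¹ ^ ℓ))

/-- `x` is a normal infinite word. -/
def Normal [Fintype A] (x : ℕ → A) : Prop := ∀ ℓ : ℕ, 1 ≤ ℓ → SimplyNormalTo x ℓ

/-! ### Two-tape automata -/

/-- A `2`-automaton with input alphabets `A`, `B` and state set `Q`;
`none` plays the role of the empty word `ε` in transition labels. -/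
structure TwoAut (A B Q : Type*) where
  init : Set Q
  trans : Set (Q × (Option A × Option B) × Q)

/-- The support of a label. -/
def lsupp (l : Option A × Option B) : Bool × Bool := (l.1.isSome, l.2.isSome)

/-- A `2`-deterministic `2`-automaton. -/
def TwoAut.TwoDet (M : TwoAut A B Q) : Prop :=
  (∃ q₀, M.init = {q₀}) ∧
  ∀ t ∈ M.trans, ∀ t' ∈ M.trans, t.1 = t'.1 →
    lsupp t.2.1 = lsupp t'.2.1 ∧ (t.2.1 = t'.2.1 → t = t')

/-- A `1`-deterministic `2`-automaton. -/
def TwoAut.OneDet (M : TwoAut A B Q) : Prop :=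
  (∃ q₀, M.init = {q₀}) ∧
  ∀ t ∈ M.trans, ∀ t' ∈ M.trans, t.1 = t'.1 →
    t.2.1.1.isSome = t'.2.1.1.isSome ∧ (t.2.1.1 = t'.2.1.1 → t = t')

/-- `2`-completeness. -/
def TwoAut.TwoComplete (M : TwoAut A B Q) : Prop :=
  ∀ (q : Q) (l l' : Option A × Option B),
    (∃ q', (q, l, q') ∈ M.trans) → lsupp l' = lsupp l → ∃ q', (q, l', q') ∈ M.trans

/-- Every transition reads exactly one symbol. -/
def TwoAut.OneSymbol (M : TwoAut A B Q) : Prop :=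
  ∀ t ∈ M.trans, lsupp t.2.1 = (true, false) ∨ lsupp t.2.1 = (false, true)

def TwoAut.Step (M : TwoAut A B Q) (p q : Q) : Prop := ∃ l, (p, l, q) ∈ M.trans

/-- There is a finite run from `p` to `q`. -/
def TwoAut.Reaches (M : TwoAut A B Q) : Q → Q → Prop := Relation.ReflTransGen M.Step

def TwoAut.StronglyConnected (M : TwoAut A B Q) : Prop := ∀ p q, M.Reaches p q

/-- Word read on the first tape by the first `n` transitions of `γ`. -/
def in1 (γ : ℕ → Q × (Option A × Option B) × Q) (n : ℕ) : List A :=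
  ((List.range n).map fun i => (γ i).2.1.1).reduceOption

/-- Word read on the second tape by the first `n` transitions of `γ`. -/
def in2 (γ : ℕ → Q × (Option A × Option B) × Q) (n : ℕ) : List B :=
  ((List.range n).map fun i => (γ i).2.1.2).reduceOption

/-- `γ` is an infinite run of `M` (not necessarily from the initial state) whose
two input labels are the infinite words `x` and `y`. -/
def TwoAut.IsRunOn (M : TwoAut A B Q) (γ : ℕ → Q × (Option A × Option B) × Q)
    (x : ℕ → A) (y : ℕ → B) : Prop :=
  (∀ n, γ n ∈ M.trans) ∧ (∀ n, (γ n).2.2 = (γ (n + 1)).1) ∧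
  (∀ n, in1 γ n = pref x (in1 γ n).length) ∧ (∀ n, in2 γ n = pref y (in2 γ n).length) ∧
  Tendsto (fun n => (in1 γ n).length) atTop atTop ∧
  Tendsto (fun n => (in2 γ n).length) atTop atTop

/-- The pair `(x, y)` is accepted by `M`. -/
def TwoAut.Accepts (M : TwoAut A B Q) (x : ℕ → A) (y : ℕ → B) : Prop :=
  ∃ γ, (γ 0).1 ∈ M.init ∧ M.IsRunOn γ x y

/-- Number of occurrences of the state `q` among the first `n` transitions of `γ`. -/
noncomputable def stateCount (γ : ℕ → Q × (Option A × Option B) × Q) (q : Q) (n : ℕ) : ℕ :=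
  Nat.card {i : ℕ | i < n ∧ (γ i).1 = q}

/-- Number of occurrences of the transition `τ` among the first `n` transitions of `γ`. -/
noncomputable def transCount (γ : ℕ → Q × (Option A × Option B) × Q)
    (τ : Q × (Option A × Option B) × Q) (n : ℕ) : ℕ :=
  Nat.card {i : ℕ | i < n ∧ γ i = τ}

/-! ### Markov chain associated with a one-symbol automaton -/

/-- The `(p,q)` entry of the Markov matrix associated with the transition set `T`. -/
noncomputable def markovOf {S : Type*} [Fintype A] [Fintype B]
    (T : Set (S × (Option A × Option B) × S)) (p q : S) : ℝ :=
  (Nat.card {a : A | (p, (some a, none), q) ∈ T} : ℝ) / (Fintype.card A : ℝ) +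
  (Nat.card {b : B | (p, (none, some b), q) ∈ T} : ℝ) / (Fintype.card B : ℝ)

/-- `π` is a stationary distribution for the transition set `T` restricted to the
finite state set `st`. -/
def IsStationaryOn {S : Type*} [Fintype A] [Fintype B]
    (T : Set (S × (Option A × Option B) × S)) (st : Finset S) (π : S → ℝ) : Prop :=
  (∀ s ∈ st, 0 ≤ π s) ∧ (∑ s ∈ st, π s = 1) ∧
  ∀ q ∈ st, (∑ p ∈ st, π p * markovOf T p q) = π q

/-- `π` is a stationary distribution of the Markov chain associated with `M`. -/
def TwoAut.IsStationary [Fintype A] [Fintype B] [Fintype Q]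
    (M : TwoAut A B Q) (π : Q → ℝ) : Prop :=
  IsStationaryOn M.trans Finset.univ π

/-- The frequency property for the pair `(x, y)`: in every strongly connected
`2`-deterministic `2`-automaton (reading one symbol per transition), every infinite run
on a suffix of `x` and a suffix of `y` visits each state with frequency given by the
stationary distribution, and the automaton is `2`-complete. -/
def FreqProp [Fintype A] [Fintype B] (x : ℕ → A) (y : ℕ → B) : Prop :=
  ∀ (Q' : Type) [Fintype Q'] (M : TwoAut A B Q'), M.TwoDet → M.OneSymbol →
    M.StronglyConnected →
    ∀ (i j : ℕ) (γ : ℕ → Q' × (Option A × Option B) × Q'),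
      M.IsRunOn γ (fun n => x (n + i)) (fun n => y (n + j)) →
      M.TwoComplete ∧
      ∃ π : Q' → ℝ, M.IsStationary π ∧
        ∀ q, Tendsto (fun n : ℕ => (stateCount γ q n : ℝ) / n) atTop (nhds (π q))

/-! ### Conditional compressors (2-deterministic 3-automata) -/

/-- A `3`-automaton with two input tapes (alphabets `A` and `B`) and one
output tape (alphabet `D`), with a single initial state. -/
structure Comp3 (A B D Q : Type*) where
  init : Q
  trans : Set (Q × (Option A × Option B) × List D × Q)

/-- `2`-determinism for `3`-automata. -/
def Comp3.TwoDet (C : Comp3 A B D Q) : Prop :=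
  ∀ t ∈ C.trans, ∀ t' ∈ C.trans, t.1 = t'.1 →
    lsupp t.2.1 = lsupp t'.2.1 ∧ (t.2.1 = t'.2.1 → t = t')

def c3in1 (γ : ℕ → Q × (Option A × Option B) × List D × Q) (n : ℕ) : List A :=
  ((List.range n).map fun i => (γ i).2.1.1).reduceOption

def c3in2 (γ : ℕ → Q × (Option A × Option B) × List D × Q) (n : ℕ) : List B :=
  ((List.range n).map fun i => (γ i).2.1.2).reduceOption

def c3out (γ : ℕ → Q × (Option A × Option B) × List D × Q) (n : ℕ) : List D :=
  ((List.range n).map fun i => (γ i).2.2.1).flatten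

/-- `γ` is the accepting run of `C` on the pair `(x, y)`. -/
def Comp3.IsAccRunOn (C : Comp3 A B D Q) (γ : ℕ → Q × (Option A × Option B) × List D × Q)
    (x : ℕ → A) (y : ℕ → B) : Prop :=
  (γ 0).1 = C.init ∧ (∀ n, γ n ∈ C.trans) ∧ (∀ n, (γ n).2.2.2 = (γ (n + 1)).1) ∧
  (∀ n, c3in1 γ n = pref x (c3in1 γ n).length) ∧
  (∀ n, c3in2 γ n = pref y (c3in2 γ n).length) ∧
  Tendsto (fun n => (c3in1 γ n).length) atTop atTop ∧
  Tendsto (fun n => (c3in2 γ n).length) atTop atTop ∧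
  Tendsto (fun n => (c3out γ n).length) atTop atTop

/-- For every fixed second input `y`, the input-output map `x ↦ C(x,y)` is one-to-one. -/
def Comp3.OneToOne (C : Comp3 A B D Q) : Prop :=
  ∀ (x x' : ℕ → A) (y : ℕ → B) γ γ', C.IsAccRunOn γ x y → C.IsAccRunOn γ' x' y →
    (∀ n, ∃ m, c3out γ n <+: c3out γ' m) → (∀ n, ∃ m, c3out γ' n <+: c3out γ m) →
    x = x'

/-- The conditional compression ratio `ρ(x/y)`: the infimum, over all conditional
compressors, of the compression ratio of `x` given the oracle `y`. -/
noncomputable def condRho [Fintype A] [Fintype B] (x : ℕ → A) (y : ℕ → B) : ℝ :=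
  sInf {r : ℝ | ∃ (m d : ℕ), 2 ≤ d ∧ ∃ C : Comp3 A B (Fin d) (Fin m),
    C.TwoDet ∧ C.OneToOne ∧ ∃ γ, C.IsAccRunOn γ x y ∧
      r = Filter.liminf (fun n : ℕ =>
        (((c3out γ n).length : ℝ) * Real.log d) /
        (((c3in1 γ n).length : ℝ) * Real.log (Fintype.card A))) atTop}

/-! ### Compressors (one-to-one 1-deterministic 2-automata) -/

/-- A `2`-automaton with one input tape (alphabet `A`) and one output tape
(alphabet `D`), with a single initial state. -/
structure Comp2 (A D Q : Type*) where
  init : Q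
  trans : Set (Q × Option A × List D × Q)

def Comp2.OneDet (C : Comp2 A D Q) : Prop :=
  ∀ t ∈ C.trans, ∀ t' ∈ C.trans, t.1 = t'.1 →
    t.2.1.isSome = t'.2.1.isSome ∧ (t.2.1 = t'.2.1 → t = t')

def c2in (γ : ℕ → Q × Option A × List D × Q) (n : ℕ) : List A :=
  ((List.range n).map fun i => (γ i).2.1).reduceOption

def c2out (γ : ℕ → Q × Option A × List D × Q) (n : ℕ) : List D :=
  ((List.range n).map fun i => (γ i).2.2.1).flatten

def Comp2.IsAccRunOn (C : Comp2 A D Q) (γ : ℕ → Q × Option A × List D × Q)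
    (x : ℕ → A) : Prop :=
  (γ 0).1 = C.init ∧ (∀ n, γ n ∈ C.trans) ∧ (∀ n, (γ n).2.2.2 = (γ (n + 1)).1) ∧
  (∀ n, c2in γ n = pref x (c2in γ n).length) ∧
  Tendsto (fun n => (c2in γ n).length) atTop atTop ∧
  Tendsto (fun n => (c2out γ n).length) atTop atTop

def Comp2.OneToOne (C : Comp2 A D Q) : Prop :=
  ∀ (x x' : ℕ → A) γ γ', C.IsAccRunOn γ x → C.IsAccRunOn γ' x' →
    (∀ n, ∃ m, c2out γ n <+: c2out γ' m) → (∀ n, ∃ m, c2out γ' n <+: c2out γ m) →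
    x = x'

/-- The compression ratio `ρ(x)`. -/
noncomputable def rho [Fintype A] (x : ℕ → A) : ℝ :=
  sInf {r : ℝ | ∃ (m d : ℕ), 2 ≤ d ∧ ∃ C : Comp2 A (Fin d) (Fin m),
    C.OneDet ∧ C.OneToOne ∧ ∃ γ, C.IsAccRunOn γ x ∧
      r = Filter.liminf (fun n : ℕ =>
        (((c2out γ n).length : ℝ) * Real.log d) /
        (((c2in γ n).length : ℝ) * Real.log (Fintype.card A))) atTop}

/-- Finite-state independence. -/
def FSIndep [Fintype A] [Fintype B] (x : ℕ → A) (y : ℕ → B) : Prop :=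
  condRho x y = rho x ∧ condRho y x = rho y ∧ 0 < rho x ∧ 0 < rho y

/-! ### Oblivious selectors with two input tapes -/

/-- Types of states of a selector. -/
inductive SelTy | I | II | III

/-- An oblivious selector with first input alphabet `A` and second input alphabet `B`:
at a state of type I it reads the next symbol of the first input and selects it, at a
state of type II it reads the next symbol of the first input without selecting it, and
at a state of type III it reads the next symbol of the second input. -/
structure Sel2 (A B : Type*) where
  states : ℕ
  init : Fin states
  ty : Fin states → SelTy
  δa : Fin states → A → Fin states
  δb : Fin states → B → Fin states

/-- Configuration (current state, symbols read from `x`, symbols read from `y`)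
after `n` steps. -/
def Sel2.cfg (S : Sel2 A B) (x : ℕ → A) (y : ℕ → B) : ℕ → Fin S.states × ℕ × ℕ
  | 0 => (S.init, 0, 0)
  | n + 1 =>
    let c := S.cfg x y n
    match S.ty c.1 with
    | SelTy.I => (S.δa c.1 (x c.2.1), c.2.1 + 1, c.2.2)
    | SelTy.II => (S.δa c.1 (x c.2.1), c.2.1 + 1, c.2.2)
    | SelTy.III => (S.δb c.1 (y c.2.2), c.2.1, c.2.2 + 1)

/-- The word selected from `x` during the first `n` steps. -/
def Sel2.outList (S : Sel2 A B) (x : ℕ → A) (y : ℕ → B) (n : ℕ) : List A :=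
  (List.range n).filterMap fun i =>
    let c := S.cfg x y i
    match S.ty c.1 with
    | SelTy.I => some (x c.2.1)
    | SelTy.II => none
    | SelTy.III => none

/-! ### Oblivious one-input selection automata -/

/-- An oblivious selection automaton with a single input tape. -/
structure Sel1 (B : Type*) where
  states : ℕ
  init : Fin states
  sel : Fin states → Bool
  δ : Fin states → B → Fin states

/-- State after reading the first `n` symbols of `y`. -/
def Sel1.st (S : Sel1 B) (y : ℕ → B) : ℕ → Fin S.states
  | 0 => S.init
  | n + 1 => S.δ (S.st y n) (y n)

/-- The word selected from the first `n` symbols of `y`. -/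
def Sel1.outList (S : Sel1 B) (y : ℕ → B) (n : ℕ) : List B :=
  (List.range n).filterMap fun i => if S.sel (S.st y i) then some (y i) else none

/-! ### Shufflers -/

/-- A shuffler over the alphabet `A`: at a state of type I it reads, outputs and moves
on the next symbol of the first input; at a state of type II it does so with the second
input. -/
structure Shuffler (A : Type*) where
  states : ℕ
  init : Fin states
  tyI : Fin states → Bool
  δ : Fin states → A → Fin states

/-- Configuration (current state, symbols read from `x`, symbols read from `y`)
after `n` steps. -/
def Shuffler.cfg (S : Shuffler A) (x y : ℕ → A) : ℕ → Fin S.states × ℕ × ℕ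
  | 0 => (S.init, 0, 0)
  | n + 1 =>
    let c := S.cfg x y n
    if S.tyI c.1 then (S.δ c.1 (x c.2.1), c.2.1 + 1, c.2.2)
    else (S.δ c.1 (y c.2.2), c.2.1, c.2.2 + 1)

/-- The output `S(x,y)` of the shuffler `S` on inputs `x` and `y`. -/
def Shuffler.out (S : Shuffler A) (x y : ℕ → A) (n : ℕ) : A :=
  let c := S.cfg x y n
  if S.tyI c.1 then x c.2.1 else y c.2.2

/-! ### Look-ahead automata -/

/-- The transitions of the look-ahead automaton `𝒜_{k,ℓ}`. -/
def lookTrans (M : TwoAut A B Q) (k ℓ : ℕ) :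
    Set ((Q × List A × List B) × (Option A × Option B) × (Q × List A × List B)) :=
  {t | (∃ (q : Q) (u : List A) (a : A), u.length < k ∧
          t = ((q, u, []), (some a, none), (q, u ++ [a], ([] : List B)))) ∨
       (∃ (q : Q) (u : List A) (v : List B) (b : B), u.length = k ∧ v.length < ℓ ∧
          t = ((q, u, v), (none, some b), (q, u, v ++ [b]))) ∨
       (∃ (q q' : Q) (a a' : A) (u' : List A) (v : List B),
          u'.length = k - 1 ∧ v.length = ℓ ∧ (q, (some a, none), q') ∈ M.trans ∧
          t = ((q, a :: u', v), (some a', none), (q', u' ++ [a'], v))) ∨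
       (∃ (q q' : Q) (b b' : B) (u : List A) (v' : List B),
          u.length = k ∧ v'.length = ℓ - 1 ∧ (q, (none, some b), q') ∈ M.trans ∧
          t = ((q, u, b :: v'), (none, some b'), (q', u, v' ++ [b'])))}

/-- The (finite) set of states of the look-ahead automaton with full buffers,
i.e. `Q × A^k × B^ℓ`. -/
noncomputable def fullFinset (Q A B : Type*) [Fintype Q] [Fintype A] [Fintype B]
    (k ℓ : ℕ) : Finset (Q × List A × List B) :=
  letI := Classical.decEq (Q × List A × List B)
  (Finset.univ : Finset (Q × (Fin k → A) × (Fin ℓ → B))).image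
    fun s => (s.1, List.ofFn s.2.1, List.ofFn s.2.2)

/-! ### Counting words and measures -/

/-- The number of words of length `n` with exactly `i` occurrences of `γ`. -/
noncomputable def Ncount (γ : List A) (i n : ℕ) : ℕ :=
  Nat.card {w : List A // w.length = n ∧ occ w γ = i}

/-- The cylinder of infinite words starting with `w`. -/
def cylinder (w : List A) : Set (ℕ → A) := {x : ℕ → A | pref x w.length = w}

/-- The set `E_S(ε,γ,n)` of pairs of inputs for which the frequency of `γ` in the first
`n` symbols of `S(x,y)` deviates from `|A|^{-|γ|}` by less than `ε`. -/
def Eset [Fintype A] (S : Shuffler A) (ε : ℝ) (γ : List A) (n : ℕ) :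
    Set ((ℕ → A) × (ℕ → A)) :=
  {p : (ℕ → A) × (ℕ → A) |
    |(occ (pref (S.out p.1 p.2) n) γ : ℝ) - (n : ℝ) / (Fintype.card A : ℝ) ^ γ.length|
      < ε * n}

/-- The set `F(ε,t,ℓ,n)`. -/
def Fset [Fintype A] (S : ℕ → Shuffler A) (ε : ℝ) (t ℓ n : ℕ) :
    Set ((ℕ → A) × (ℕ → A)) :=
  ⋂ i ∈ Finset.Icc 1 t, ⋂ r ∈ Finset.Icc 1 ℓ,
    ⋂ γ ∈ {γ : List A | γ.length = r}, Eset (S i) ε γ n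

/-- `ℓ_n = (log_{|A|} n)/3`. -/
noncomputable def ellSeq (A : Type*) [Fintype A] (n : ℕ) : ℝ :=
  Real.logb (Fintype.card A) n / 3

/-- `ε_n = 2 √((log n · log_{|A|} n)/n)`. -/
noncomputable def epsSeq (A : Type*) [Fintype A] (n : ℕ) : ℝ :=
  2 * Real.sqrt (Real.log n * Real.logb (Fintype.card A) n / n)

/-- `F_n = F(ε_n, t_n, ℓ_n, n)` with `t_n = n`. -/
noncomputable def Fn [Fintype A] (S : ℕ → Shuffler A) (n : ℕ) :
    Set ((ℕ → A) × (ℕ → A)) :=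
  Fset S (epsSeq A n) n (⌊ellSeq A n⌋).toNat n

/-- `n_start`, the least `n` such that `ε_n ≥ 6/⌊n/ℓ_n⌋`. -/
noncomputable def nStart (A : Type*) [Fintype A] : ℕ :=
  sInf {m : ℕ | 0 < ⌊(m : ℝ) / ellSeq A m⌋ ∧
    6 / ((⌊(m : ℝ) / ellSeq A m⌋ : ℤ) : ℝ) ≤ epsSeq A m}

/-- `G_n = ⋂_{j=0}^{n} F_{|A|^{n_0+j}}` where `|A|^{n_0} = n_start`. -/
noncomputable def Gn [Fintype A] (S : ℕ → Shuffler A) (n : ℕ) :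
    Set ((ℕ → A) × (ℕ → A)) :=
  ⋂ j ∈ Finset.range (n + 1), Fn S (nStart A * Fintype.card A ^ j)

open scoped Classical in
/-- Number of indices `q < m` such that the `q`-th aligned block of `w` of length `|γ|`
equals `γ`. -/
noncomputable def blockCount (γ : List A) (m : ℕ) (w : List A) : ℕ :=
  ((Finset.range m).filter fun q => (w.drop (q * γ.length)).take γ.length = γ).card

/-- The occurrences of `γ` in `w` split according to the residue of their position
modulo `|γ|`. -/
theorem occ_eq_sum_blockCount (γ w : List A) (hγ : 0 < γ.length) :
    occ w γ = ∑ j ∈ Finset.range γ.length,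
      blockCount γ ((w.length - j) / γ.length) (w.drop j) := by
  classical
  have hset : {i : ℕ | i + γ.length ≤ w.length ∧ (w.drop i).take γ.length = γ} =
      ((Finset.range (w.length + 1)).filter fun i =>
        i + γ.length ≤ w.length ∧ (w.drop i).take γ.length = γ : Finset ℕ) := by
    ext i
    simp only [Set.mem_ofPred_eq, Finset.coe_filter, Finset.mem_range]
    constructor
    · rintro ⟨h₁, h₂⟩
      exact ⟨by omega, h₁, h₂⟩
    · rintro ⟨_, h⟩
      exact h
  unfold occ blockCount
  rw [hset, Nat.card_coe_set_eq, Set.ncard_coe_finset, ← Finset.card_sigma]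
  refine Finset.card_nbij' (fun i => ⟨i % γ.length, i / γ.length⟩)
    (fun x => x.1 + x.2 * γ.length) ?_ ?_ ?_ ?_
  · intro i hi
    simp only [Finset.coe_filter, Finset.mem_range, Set.mem_ofPred_eq] at hi
    obtain ⟨_, h₁, h₂⟩ := hi
    have hmod : i % γ.length + i / γ.length * γ.length = i := Nat.mod_add_div' i _
    simp only [Finset.coe_sigma, Set.mem_sigma_iff, Finset.coe_filter, Finset.mem_range,
      Set.mem_ofPred_eq, Finset.coe_range, Set.mem_Iio, List.drop_drop, hmod]
    refine ⟨Nat.mod_lt _ hγ, ?_, h₂⟩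
    rw [← Nat.succ_le_iff, Nat.le_div_iff_mul_le hγ, Nat.succ_mul]
    omega
  · rintro ⟨j, q⟩ hx
    simp only [Finset.coe_sigma, Set.mem_sigma_iff, Finset.coe_filter, Finset.mem_range,
      Set.mem_ofPred_eq, Finset.coe_range, Set.mem_Iio, List.drop_drop] at hx
    obtain ⟨_, h₁, h₂⟩ := hx
    rw [← Nat.succ_le_iff, Nat.le_div_iff_mul_le hγ, Nat.succ_mul] at h₁
    simp only [Finset.coe_filter, Finset.mem_range, Set.mem_ofPred_eq]
    exact ⟨by omega, by omega, h₂⟩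
  · intro i _
    exact Nat.mod_add_div' i _
  · rintro ⟨j, q⟩ hx
    simp only [Finset.coe_sigma, Set.mem_sigma_iff, Finset.coe_range, Set.mem_Iio] at hx
    have h₁ : (j + q * γ.length) % γ.length = j := by
      rw [Nat.add_mul_mod_self_right, Nat.mod_eq_of_lt hx.1]
    have h₂ : (j + q * γ.length) / γ.length = q := by
      rw [Nat.add_mul_div_right _ _ hγ, Nat.div_eq_of_lt hx.1, zero_add]
    simp only [h₁, h₂]

open scoped Classical in
theorem blockCount_succ_append (γ u v : List A) (m : ℕ) (hu : u.length = γ.length) :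
    blockCount γ (m + 1) (u ++ v) = (if u = γ then 1 else 0) + blockCount γ m v := by
  unfold blockCount
  rw [Finset.card_filter, Finset.sum_range_succ', Finset.card_filter, add_comm]
  congr 1
  · simp [List.take_left' hu]
  · refine Finset.sum_congr rfl fun q _ => ?_
    rw [Nat.succ_mul, Nat.add_comm, ← List.drop_drop, List.drop_left' hu]

theorem sum_ofFn_add [Fintype A] (a b : ℕ) (g : List A → ℝ) :
    ∑ f : Fin (a + b) → A, g (List.ofFn f) =
      ∑ u : Fin a → A, ∑ v : Fin b → A, g (List.ofFn u ++ List.ofFn v) := by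
  rw [← (Fin.appendEquiv a b).sum_comp, Fintype.sum_prod_type]
  simp [Fin.appendEquiv, List.ofFn_fin_append]

open scoped Classical in
theorem sum_pow_ite_ofFn_eq [Fintype A] (γ : List A) (c : ℝ) :
    ∑ u : Fin γ.length → A, c ^ (if List.ofFn u = γ then 1 else 0) =
      (Fintype.card A : ℝ) ^ γ.length - 1 + c := by
  have h : ∀ u : Fin γ.length → A, c ^ (if List.ofFn u = γ then 1 else 0) =
      1 + if u = γ.get then c - 1 else 0 := by
    intro u
    have : List.ofFn u = γ ↔ u = γ.get := by
      rw [← List.ofFn_injective.eq_iff (a := u) (b := γ.get), List.ofFn_get]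
    by_cases hu : u = γ.get
    · rw [if_pos (this.2 hu), if_pos hu]; ring
    · rw [if_neg (fun h => hu (this.1 h)), if_neg hu]; ring
  simp only [h, Finset.sum_add_distrib, Finset.sum_ite_eq', Finset.mem_univ, if_true]
  simp
  ring

theorem sum_pow_blockCount [Fintype A] (γ : List A) (c : ℝ) (m s : ℕ) :
    ∑ f : Fin (m * γ.length + s) → A, c ^ blockCount γ m (List.ofFn f) =
      ((Fintype.card A : ℝ) ^ γ.length - 1 + c) ^ m * (Fintype.card A : ℝ) ^ s := by
  classical
  induction m with
  | zero => simp [blockCount]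
  | succ m ih =>
    have hN : (m + 1) * γ.length + s = γ.length + (m * γ.length + s) := by ring
    rw [hN, sum_ofFn_add γ.length _ fun w => c ^ blockCount γ (m + 1) w]
    simp only [blockCount_succ_append γ (List.ofFn _) _ m (List.length_ofFn), pow_add c]
    rw [← Finset.sum_mul_sum, sum_pow_ite_ofFn_eq, ih]
    ring

theorem sum_pow_blockCount_drop [Fintype A] (γ : List A) (c : ℝ) (j m n : ℕ)
    (h : j + m * γ.length ≤ n) :
    ∑ f : Fin n → A, c ^ blockCount γ m ((List.ofFn f).drop j) =
      (Fintype.card A : ℝ) ^ j * (((Fintype.card A : ℝ) ^ γ.length - 1 + c) ^ m *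
        (Fintype.card A : ℝ) ^ (n - j - m * γ.length)) := by
  obtain ⟨s, rfl⟩ := Nat.exists_eq_add_of_le h
  have hs : j + m * γ.length + s - j - m * γ.length = s := by omega
  rw [hs, Nat.add_assoc, sum_ofFn_add j _ fun w => c ^ blockCount γ m (w.drop j)]
  simp only [List.drop_left' (List.length_ofFn), sum_pow_blockCount]
  simp

/-- Exponential moment bound for the number of aligned blocks equal to `γ`. -/
theorem sum_exp_blockCount_drop_le [Fintype A] [Nonempty A] (γ : List A) (l : ℝ) (j m n : ℕ)
    (h : j + m * γ.length ≤ n) :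
    ∑ f : Fin n → A, Real.exp (l * blockCount γ m ((List.ofFn f).drop j)) ≤
      (Fintype.card A : ℝ) ^ n *
        Real.exp (m * (1 / (Fintype.card A : ℝ) ^ γ.length) * (Real.exp l - 1)) := by
  have hk : (1 : ℝ) ≤ Fintype.card A := by exact_mod_cast Fintype.card_pos (α := A)
  have hkr : (1 : ℝ) ≤ (Fintype.card A : ℝ) ^ γ.length := one_le_pow₀ hk
  have h₁ : ∀ i : ℕ, Real.exp (l * i) = Real.exp l ^ i := fun i => by
    rw [mul_comm, Real.exp_nat_mul]
  simp only [h₁]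
  rw [sum_pow_blockCount_drop γ _ j m n h]
  have h₂ : (Fintype.card A : ℝ) ^ γ.length - 1 + Real.exp l ≤
      (Fintype.card A : ℝ) ^ γ.length *
        Real.exp (1 / (Fintype.card A : ℝ) ^ γ.length * (Real.exp l - 1)) := by
    have := Real.add_one_le_exp (1 / (Fintype.card A : ℝ) ^ γ.length * (Real.exp l - 1))
    calc _ = (Fintype.card A : ℝ) ^ γ.length *
        (1 / (Fintype.card A : ℝ) ^ γ.length * (Real.exp l - 1) + 1) := by field_simp; ring
      _ ≤ _ := by gcongr
  have h₃ : 0 ≤ (Fintype.card A : ℝ) ^ γ.length - 1 + Real.exp l := by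
    have := Real.exp_pos l
    linarith
  calc _ ≤ (Fintype.card A : ℝ) ^ j * (((Fintype.card A : ℝ) ^ γ.length *
        Real.exp (1 / (Fintype.card A : ℝ) ^ γ.length * (Real.exp l - 1))) ^ m *
        (Fintype.card A : ℝ) ^ (n - j - m * γ.length)) := by gcongr
    _ = (Fintype.card A : ℝ) ^ (j + m * γ.length + (n - j - m * γ.length)) *
        Real.exp (1 / (Fintype.card A : ℝ) ^ γ.length * (Real.exp l - 1)) ^ m := by
      rw [mul_pow, ← pow_mul, pow_add, pow_add, mul_comm γ.length m]
      ring
    _ = _ := by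
      rw [← Real.exp_nat_mul]
      congr 2
      · omega
      · ring

open scoped Classical in
theorem sum_Ncount_eq_card [Fintype A] (γ : List A) (n : ℕ) (t : Finset ℕ) :
    ∑ i ∈ t, (Ncount γ i n : ℝ) =
      ((Finset.univ : Finset (Fin n → A)).filter
        fun f => occ (List.ofFn f) γ ∈ t).card := by
  have h : ∀ i, Ncount γ i n =
      ((Finset.univ : Finset (Fin n → A)).filter fun f => occ (List.ofFn f) γ = i).card := by
    intro i
    rw [Ncount, ← Nat.card_eq_finsetCard]
    refine (Nat.card_eq_of_bijective (fun f => ⟨List.ofFn f.1, List.length_ofFn,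
      (Finset.mem_filter.1 f.2).2⟩) ⟨fun f g hfg => ?_, ?_⟩).symm
    · exact Subtype.ext (List.ofFn_injective (congrArg Subtype.val hfg))
    · rintro ⟨w, rfl, hw⟩
      exact ⟨⟨w.get, by simpa using hw⟩, Subtype.ext (List.ofFn_get w)⟩
  simp only [h]
  rw [← Nat.cast_sum, Finset.sum_card_fiberwise_eq_card_filter]

open scoped Classical in
/-- Chernoff bound for the number of occurrences of `γ` (upper tail for `l ≥ 0`,
lower tail for `l ≤ 0`). -/
theorem card_occ_tail_le [Fintype A] [Nonempty A] (γ : List A) (hγ : 0 < γ.length) (n : ℕ)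
    (hn : γ.length ≤ n) (l T C : ℝ)
    (hC : ∀ m : ℕ, (n : ℝ) / γ.length - 2 ≤ m → (m : ℝ) ≤ n / γ.length →
      m * (1 / (Fintype.card A : ℝ) ^ γ.length) * (Real.exp l - 1) - l * (T / γ.length) ≤ C) :
    (((Finset.univ : Finset (Fin n → A)).filter
        fun f => l * T ≤ l * occ (List.ofFn f) γ).card : ℝ) ≤
      γ.length * ((Fintype.card A : ℝ) ^ n * Real.exp C) := by
  have hr : (0 : ℝ) < γ.length := by exact_mod_cast hγ
  have hpt : ∀ f : Fin n → A, l * T ≤ l * occ (List.ofFn f) γ →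
      (1 : ℝ) ≤ ∑ j ∈ Finset.range γ.length, Real.exp
        (l * blockCount γ ((n - j) / γ.length) ((List.ofFn f).drop j) -
          l * (T / γ.length)) := by
    intro f hf
    have hsum : ∑ _j ∈ Finset.range γ.length, (0 : ℝ) ≤ ∑ j ∈ Finset.range γ.length,
        (l * blockCount γ ((n - j) / γ.length) ((List.ofFn f).drop j) -
          l * (T / γ.length)) := by
      rw [occ_eq_sum_blockCount γ _ hγ, List.length_ofFn] at hf
      push_cast at hf
      rw [Finset.sum_const_zero, Finset.sum_sub_distrib, ← Finset.mul_sum, Finset.sum_const,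
        Finset.card_range, nsmul_eq_mul, mul_left_comm, mul_div_cancel₀ _ hr.ne']
      linarith
    obtain ⟨j, hj, hj'⟩ := Finset.exists_le_of_sum_le
      (Finset.nonempty_range_iff.2 hγ.ne') hsum
    exact (Real.one_le_exp hj').trans
      (Finset.single_le_sum (f := fun j => Real.exp
        (l * blockCount γ ((n - j) / γ.length) ((List.ofFn f).drop j) -
          l * (T / γ.length))) (fun _ _ => (Real.exp_pos _).le) hj)
  calc _ = ∑ f ∈ (Finset.univ : Finset (Fin n → A)).filter
        fun f => l * T ≤ l * occ (List.ofFn f) γ, (1 : ℝ) := by simp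
    _ ≤ ∑ f ∈ (Finset.univ : Finset (Fin n → A)).filter
        fun f => l * T ≤ l * occ (List.ofFn f) γ, ∑ j ∈ Finset.range γ.length, Real.exp
        (l * blockCount γ ((n - j) / γ.length) ((List.ofFn f).drop j) -
          l * (T / γ.length)) :=
      Finset.sum_le_sum fun f hf => hpt f (Finset.mem_filter.1 hf).2
    _ ≤ ∑ f : Fin n → A, ∑ j ∈ Finset.range γ.length, Real.exp
        (l * blockCount γ ((n - j) / γ.length) ((List.ofFn f).drop j) -
          l * (T / γ.length)) :=
      Finset.sum_le_sum_of_subset_of_nonneg (Finset.filter_subset _ _)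
        fun _ _ _ => Finset.sum_nonneg fun _ _ => (Real.exp_pos _).le
    _ = ∑ j ∈ Finset.range γ.length, ∑ f : Fin n → A, Real.exp
        (l * blockCount γ ((n - j) / γ.length) ((List.ofFn f).drop j) -
          l * (T / γ.length)) := Finset.sum_comm
    _ ≤ ∑ _j ∈ Finset.range γ.length, (Fintype.card A : ℝ) ^ n * Real.exp C := by
      refine Finset.sum_le_sum fun j hj => ?_
      have hj : j < γ.length := Finset.mem_range.1 hj
      have hm : (n - j) / γ.length * γ.length ≤ n - j := Nat.div_mul_le_self _ _
      have hm' : n - j < ((n - j) / γ.length + 1) * γ.length := by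
        rw [mul_comm]; exact Nat.lt_mul_div_succ _ hγ
      simp only [Real.exp_sub]
      rw [← Finset.sum_div, div_le_iff₀ (Real.exp_pos _)]
      refine (sum_exp_blockCount_drop_le γ l j _ n (by omega)).trans ?_
      rw [mul_assoc _ (Real.exp C), ← Real.exp_add]
      gcongr
      rw [← sub_le_iff_le_add]
      refine hC _ ?_ ?_
      · rw [sub_le_iff_le_add, div_le_iff₀ hr]
        have : n ≤ ((n - j) / γ.length + 2) * γ.length := by
          rw [Nat.succ_mul]; omega
        exact_mod_cast this
      · rw [le_div_iff₀ hr]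
        have : (n - j) / γ.length * γ.length ≤ n := by omega
        exact_mod_cast this
    _ = _ := by simp

theorem exp_sub_one_le_add_sq {l : ℝ} (hl : |l| ≤ 1) : Real.exp l - 1 ≤ l + l ^ 2 := by
  have := (abs_le.1 (Real.abs_exp_sub_one_sub_id_le hl)).2
  linarith

/-- The exponent in the upper-tail Chernoff bound with parameter `K * ε / 2`. -/
theorem upper_tail_exponent_le {K ε L m : ℝ} (hK : 0 < K) (hε : 0 ≤ ε) (hKε : K * ε ≤ 1)
    (hm0 : 0 ≤ m) (hm : m ≤ L) :
    m * (1 / K) * (Real.exp (K * ε / 2) - 1) - K * ε / 2 * (L / K + ε * L) ≤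
      -(K * ε ^ 2 * L / 4) := by
  have hl0 : 0 ≤ K * ε / 2 := by positivity
  have hexp := exp_sub_one_le_add_sq (l := K * ε / 2) (abs_le.2 ⟨by linarith, by linarith⟩)
  calc m * (1 / K) * (Real.exp (K * ε / 2) - 1) - K * ε / 2 * (L / K + ε * L)
      ≤ m * (1 / K) * (K * ε / 2 + (K * ε / 2) ^ 2) - K * ε / 2 * (L / K + ε * L) := by gcongr
    _ ≤ L * (1 / K) * (K * ε / 2 + (K * ε / 2) ^ 2) - K * ε / 2 * (L / K + ε * L) := by gcongr
    _ = _ := by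
      field_simp
      ring

/-- The exponent in the lower-tail Chernoff bound with parameter `-(K * ε / 2)`. -/
theorem lower_tail_exponent_le {K ε L m : ℝ} (hK : 0 < K) (hε : 0 ≤ ε) (hKε : K * ε ≤ 1)
    (hm0 : 0 ≤ m) (hm : L - 2 ≤ m) :
    m * (1 / K) * (Real.exp (-(K * ε / 2)) - 1) - -(K * ε / 2) * (L / K - ε * L) ≤
      -(K * ε ^ 2 * L / 4) + ε - K * ε ^ 2 / 2 := by
  have hl0 : 0 ≤ K * ε / 2 := by positivity
  have hexp := exp_sub_one_le_add_sq (l := -(K * ε / 2)) (abs_le.2 ⟨by linarith, by linarith⟩)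
  have hneg : 0 ≤ ε / 2 - K * ε ^ 2 / 4 := by nlinarith
  calc m * (1 / K) * (Real.exp (-(K * ε / 2)) - 1) - -(K * ε / 2) * (L / K - ε * L)
      ≤ m * (1 / K) * (-(K * ε / 2) + (-(K * ε / 2)) ^ 2) -
          -(K * ε / 2) * (L / K - ε * L) := by gcongr
    _ = -(m * (ε / 2 - K * ε ^ 2 / 4)) - -(K * ε / 2) * (L / K - ε * L) := by
      field_simp
      ring
    _ ≤ -((L - 2) * (ε / 2 - K * ε ^ 2 / 4)) - -(K * ε / 2) * (L / K - ε * L) := by gcongr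
    _ = _ := by
      field_simp
      ring

open scoped Classical in
theorem sum_Ncount_le_pow [Fintype A] (γ : List A) (n : ℕ) (t : Finset ℕ) :
    ∑ i ∈ t, (Ncount γ i n : ℝ) ≤ (Fintype.card A : ℝ) ^ n := by
  rw [sum_Ncount_eq_card]
  have := Finset.card_filter_le (Finset.univ : Finset (Fin n → A))
    fun f => occ (List.ofFn f) γ ∈ t
  rw [Finset.card_univ, Fintype.card_fun, Fintype.card_fin] at this
  exact_mod_cast this

open scoped Classical in
theorem sum_Ncount_tail_le [Fintype A] [Nonempty A] (γ : List A) (hγ : 0 < γ.length) (n : ℕ)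
    (hn : γ.length ≤ n) (l T C : ℝ) (t : Finset ℕ) (ht : ∀ i ∈ t, l * T ≤ l * i)
    (hC : ∀ m : ℕ, (n : ℝ) / γ.length - 2 ≤ m → (m : ℝ) ≤ n / γ.length →
      m * (1 / (Fintype.card A : ℝ) ^ γ.length) * (Real.exp l - 1) - l * (T / γ.length) ≤ C) :
    ∑ i ∈ t, (Ncount γ i n : ℝ) ≤
      γ.length * ((Fintype.card A : ℝ) ^ n * Real.exp C) := by
  rw [sum_Ncount_eq_card]
  refine le_trans ?_ (card_occ_tail_le γ hγ n hn l T C hC)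
  exact_mod_cast Finset.card_le_card
    (Finset.monotone_filter_right _ fun f _ hf => ht _ hf)

open scoped Classical in
/-- adapted from Hardy–Wright. The number of words of length `n`
whose number of occurrences of `γ ∈ A^r` deviates from `n/|A|^r` by at least `εn` is
bounded by `2|A|^{n+2r-2} r e^{-|A|^r ε² n/(6r)}`. -/
theorem hardy_wright_bound {A : Type*} [Fintype A] (hA : 2 ≤ Fintype.card A)
    (r n : ℕ) (hr : 0 < r) (hn : 0 < n) (γ : List A) (hγ : γ.length = r)
    (ε : ℝ) (hε₁ : 6 / ((n / r : ℕ) : ℝ) ≤ ε)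
    (hε₂ : ε ≤ 1 / (Fintype.card A : ℝ) ^ r) :
    (((Finset.range (n + 1)).filter
        (fun i : ℕ => (i : ℝ) ≤ (n : ℝ) / (Fintype.card A : ℝ) ^ r - ε * n)).sum
        (fun i : ℕ => (Ncount γ i n : ℝ))) +
    (((Finset.range (n + 1)).filter
        (fun i : ℕ => (n : ℝ) / (Fintype.card A : ℝ) ^ r + ε * n ≤ (i : ℝ))).sum
        (fun i : ℕ => (Ncount γ i n : ℝ)))
      < 2 * (Fintype.card A : ℝ) ^ (n + 2 * r - 2) * r *
          Real.exp (-((Fintype.card A : ℝ) ^ r * ε ^ 2 * n / (6 * r))) := by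
  classical
  subst hγ
  have : Nonempty A := Fintype.card_pos_iff.1 (by omega)
  have hk : (2 : ℝ) ≤ Fintype.card A := by exact_mod_cast hA
  have hr0 : (0 : ℝ) < γ.length := by exact_mod_cast hr
  have hn0 : (0 : ℝ) < n := by exact_mod_cast hn
  set K : ℝ := (Fintype.card A : ℝ) ^ γ.length with hKdef
  have hK : 2 ≤ K := hk.trans (le_self_pow₀ (by linarith) hr.ne')
  have hK0 : 0 < K := by linarith
  have hKε : K * ε ≤ 1 := by
    rw [le_div_iff₀ hK0] at hε₂
    linarith
  have hpow : (Fintype.card A : ℝ) ^ n ≤ (Fintype.card A : ℝ) ^ (n + 2 * γ.length - 2) :=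
    pow_le_pow_right₀ (by linarith) (by omega)
  have hpow0 : 0 < (Fintype.card A : ℝ) ^ n := by positivity
  rcases lt_or_ge n γ.length with hlt | hle
  · have hε : 0 ≤ ε := by
      rw [Nat.div_eq_of_lt hlt] at hε₁
      simpa using hε₁
    have hr2 : (2 : ℝ) ≤ γ.length := by
      have : 2 ≤ γ.length := by omega
      exact_mod_cast this
    have hnr : (n : ℝ) ≤ γ.length := by exact_mod_cast hlt.le
    have hx : K * ε ^ 2 * n / (6 * γ.length) ≤ 1 / 6 := by
      rw [div_le_iff₀ (by positivity)]
      have h₁ : K * ε ^ 2 ≤ 1 := by nlinarith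
      nlinarith
    have hexp : 5 / 6 ≤ Real.exp (-(K * ε ^ 2 * n / (6 * γ.length))) := by
      have := Real.add_one_le_exp (-(K * ε ^ 2 * n / (6 * γ.length)))
      linarith
    refine (add_le_add (sum_Ncount_le_pow γ n _) (sum_Ncount_le_pow γ n _)).trans_lt ?_
    calc (Fintype.card A : ℝ) ^ n + (Fintype.card A : ℝ) ^ n
        < 2 * (Fintype.card A : ℝ) ^ n * 2 * (5 / 6) := by linarith
      _ ≤ _ := by gcongr
  · have hM : 0 < n / γ.length := Nat.div_pos hle hr
    have hM0 : (0 : ℝ) < ((n / γ.length : ℕ) : ℝ) := by exact_mod_cast hM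
    have hε : 0 < ε := lt_of_lt_of_le (by positivity) hε₁
    set L : ℝ := (n : ℝ) / γ.length with hLdef
    have hεL : 6 ≤ ε * L := by
      rw [div_le_iff₀ hM0] at hε₁
      exact hε₁.trans (mul_le_mul_of_nonneg_left Nat.cast_div_le hε.le)
    have hD : -(K * ε ^ 2 * n / (6 * γ.length)) = -(K * ε ^ 2 * L / 6) := by
      rw [hLdef]
      field_simp
    rw [hD]
    have hlow := sum_Ncount_tail_le γ hr n hle (-(K * ε / 2)) (n / K - ε * n)
      (-(K * ε ^ 2 * L / 4) + ε - K * ε ^ 2 / 2)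
      ((Finset.range (n + 1)).filter fun i : ℕ => (i : ℝ) ≤ n / K - ε * n)
      (fun i hi => mul_le_mul_of_nonpos_left (Finset.mem_filter.1 hi).2
        (neg_nonpos.2 (by positivity)))
      (fun m hm _ => by
        have hT : (n / K - ε * n) / γ.length = L / K - ε * L := by rw [hLdef]; ring
        rw [hT]
        exact lower_tail_exponent_le hK0 hε.le hKε m.cast_nonneg hm)
    have hupp := sum_Ncount_tail_le γ hr n hle (K * ε / 2) (n / K + ε * n)
      (-(K * ε ^ 2 * L / 4))
      ((Finset.range (n + 1)).filter fun i : ℕ => n / K + ε * n ≤ (i : ℝ))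
      (fun i hi => mul_le_mul_of_nonneg_left (Finset.mem_filter.1 hi).2 (by positivity))
      (fun m _ hm => by
        have hT : (n / K + ε * n) / γ.length = L / K + ε * L := by rw [hLdef]; ring
        rw [hT]
        exact upper_tail_exponent_le hK0 hε.le hKε m.cast_nonneg hm)
    have hKL : K * ε ≤ K * ε ^ 2 * L / 6 := by
      have := mul_le_mul_of_nonneg_left hεL (mul_pos hK0 hε).le
      linarith
    have hKε2 : 2 * ε ≤ K * ε := by gcongr
    have hsq : 0 < K * ε ^ 2 := by positivity
    have hlow' : Real.exp (-(K * ε ^ 2 * L / 4) + ε - K * ε ^ 2 / 2) <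
        Real.exp (-(K * ε ^ 2 * L / 6)) := Real.exp_lt_exp.2 (by linarith)
    have hupp' : Real.exp (-(K * ε ^ 2 * L / 4)) < Real.exp (-(K * ε ^ 2 * L / 6)) :=
      Real.exp_lt_exp.2 (by linarith)
    refine (add_le_add hlow hupp).trans_lt ?_
    calc _ < γ.length * ((Fintype.card A : ℝ) ^ n * Real.exp (-(K * ε ^ 2 * L / 6))) +
        γ.length * ((Fintype.card A : ℝ) ^ n * Real.exp (-(K * ε ^ 2 * L / 6))) := by gcongr
      _ = 2 * (Fintype.card A : ℝ) ^ n * γ.length *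
        Real.exp (-(K * ε ^ 2 * L / 6)) := by ring
      _ ≤ _ := by gcongr

end FSI
end

section
/- Let S be a shuffler over a finite alphabet A and let w be a finite word over A. Then (μ×μ)({(x,y) ∈ A^ω × A^ω : S(x,y) ∈ [w]}) = |A|^{−|w|}. -/
open Filter Topology

namespace FSI

variable {A B D Q : Type*}

theorem mem_cylinder_append_singleton {A : Type*} (x : ℕ → A) (w : List A) (a : A) :
    x ∈ cylinder (w ++ [a]) ↔ x ∈ cylinder w ∧ x w.length = a := by
  simp [cylinder, pref, List.range_succ, List.append_singleton_inj]

/-- The run of a shuffler is determined by its output: the pairs of inputs whose output starts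
with `w` form a product of cylinders, and on all of them the configuration reached after
`w.length` steps is the same. -/
theorem Shuffler.exists_cylinder_prod {A : Type*} (S : Shuffler A) (w : List A) :
    ∃ (q : Fin S.states) (u v : List A), u.length + v.length = w.length ∧
      {p : (ℕ → A) × (ℕ → A) | S.out p.1 p.2 ∈ cylinder w} = cylinder u ×ˢ cylinder v ∧
      ∀ x ∈ cylinder u, ∀ y ∈ cylinder v, S.cfg x y w.length = (q, u.length, v.length) := by
  induction w using List.reverseRecOn with
  | nil => exact ⟨S.init, [], [], rfl, by simp [cylinder, pref], fun _ _ _ _ => rfl⟩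
  | append_singleton w a ih =>
    obtain ⟨q, u, v, hlen, hset, hcfg⟩ := ih
    have hmem (x y : ℕ → A) : S.out x y ∈ cylinder w ↔ x ∈ cylinder u ∧ y ∈ cylinder v :=
      Set.ext_iff.mp hset (x, y)
    by_cases hq : S.tyI q
    · refine ⟨S.δ q a, u ++ [a], v, by simp; omega, ?_, fun x hx y hy => ?_⟩
      · ext ⟨x, y⟩
        simp only [Set.mem_ofPred_eq, Set.mem_prod, mem_cylinder_append_singleton, hmem]
        rw [and_right_comm (b := x u.length = a)]
        refine and_congr_right fun ⟨hx, hy⟩ => ?_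
        simp [Shuffler.out, hcfg x hx y hy, hq]
      · rw [mem_cylinder_append_singleton] at hx
        simp [Shuffler.cfg, hcfg x hx.1 y hy, hq, hx.2]
    · refine ⟨S.δ q a, u, v ++ [a], by simp; omega, ?_, fun x hx y hy => ?_⟩
      · ext ⟨x, y⟩
        simp only [Set.mem_ofPred_eq, Set.mem_prod, mem_cylinder_append_singleton, hmem]
        rw [← and_assoc]
        refine and_congr_right fun ⟨hx, hy⟩ => ?_
        simp [Shuffler.out, hcfg x hx y hy, hq]
      · rw [mem_cylinder_append_singleton] at hy
        simp [Shuffler.cfg, hcfg x hx y hy.1, hq, hy.2]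

open MeasureTheory in
/-- For a shuffler `S` and the uniform Bernoulli product measure `μ`
(characterised by its values on cylinders), the probability that `S(x,y)` starts with a
given word `w` is `|A|^{-|w|}`. -/
theorem shuffler_preimage_cylinder_measure {A : Type*} [Fintype A] [MeasurableSpace A]
    (μ : Measure (ℕ → A)) [IsProbabilityMeasure μ]
    (hμ : ∀ w : List A, μ (cylinder w) = (Fintype.card A : ENNReal)⁻¹ ^ w.length)
    (S : Shuffler A) (w : List A) :
    (μ.prod μ) {p : (ℕ → A) × (ℕ → A) | S.out p.1 p.2 ∈ cylinder w}
      = (Fintype.card A : ENNReal)⁻¹ ^ w.length := by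
  obtain ⟨-, u, v, hlen, hset, -⟩ := S.exists_cylinder_prod w
  rw [hset, Measure.prod_prod, hμ, hμ, ← pow_add, hlen]

end FSI
end

section
/- Let A be a finite alphabet with |A| ≥ 2, let S_1,…,S_t be shufflers over A, and let ε, ℓ, n satisfy 6/⌊n/ℓ⌋ ≤ ε ≤ 1/|A|^ℓ with ℓ, t, n positive integers. Then (μ×μ)(F(ε,t,ℓ,n)) > 1 − 2·t·|A|^{3ℓ−1}·e^{−ε² n/(3ℓ)}. -/
open Filter Topology

namespace FSI

variable {A B D Q : Type*}

/-! ### Shuffler outputs as measure-contracting maps -/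

theorem pref_succ (x : ℕ → A) (n : ℕ) : pref x (n + 1) = pref x n ++ [x n] := by
  simp [pref, List.range_succ]

@[simp]
theorem length_pref (x : ℕ → A) (n : ℕ) : (pref x n).length = n := by
  simp [pref]

theorem pref_eq_pref_iff {x y : ℕ → A} {n : ℕ} : pref x n = pref y n ↔ ∀ i < n, x i = y i := by
  simp [pref]

theorem mem_cylinder_pref_iff {x y : ℕ → A} {n : ℕ} :
    x ∈ cylinder (pref y n) ↔ ∀ i < n, x i = y i := by
  simp [cylinder, pref_eq_pref_iff]

theorem Shuffler.cfg_add (S : Shuffler A) (x y : ℕ → A) (n : ℕ) :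
    (S.cfg x y n).2.1 + (S.cfg x y n).2.2 = n := by
  induction n with
  | zero => simp [Shuffler.cfg]
  | succ n ih =>
    simp only [Shuffler.cfg]
    split_ifs <;> simp only <;> omega

/-- Inputs producing the same output up to time `n` have been read identically up to then. -/
theorem Shuffler.cfg_eq_of_pref_out_eq (S : Shuffler A) {x y x' y' : ℕ → A} {n : ℕ}
    (h : pref (S.out x' y') n = pref (S.out x y) n) :
    S.cfg x' y' n = S.cfg x y n ∧ (∀ i < (S.cfg x y n).2.1, x' i = x i) ∧
      ∀ i < (S.cfg x y n).2.2, y' i = y i := by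
  induction n with
  | zero => simp [Shuffler.cfg]
  | succ n ih =>
    rw [pref_succ, pref_succ] at h
    obtain ⟨h₁, h₂⟩ := List.append_inj h (by simp)
    obtain ⟨hc, hx, hy⟩ := ih h₁
    have ho : S.out x' y' n = S.out x y n := by simpa using h₂
    simp only [Shuffler.out, hc] at ho
    simp only [Shuffler.cfg, hc]
    split_ifs at ho ⊢ with hI
    · refine ⟨by simp [ho], fun i hi => ?_, hy⟩
      rcases Nat.lt_succ_iff_lt_or_eq.1 hi with hi | rfl
      exacts [hx i hi, ho]
    · refine ⟨by simp [ho], hx, fun i hi => ?_⟩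
      rcases Nat.lt_succ_iff_lt_or_eq.1 hi with hi | rfl
      exacts [hy i hi, ho]

section Shuffling

open MeasureTheory

variable [Fintype A] [MeasurableSpace A] {μ : Measure (ℕ → A)} [IsProbabilityMeasure μ]

theorem prod_pref_out_eq_le
    (hμ : ∀ w : List A, μ (cylinder w) = (Fintype.card A : ENNReal)⁻¹ ^ w.length)
    (S : Shuffler A) (n : ℕ) (w : List A) :
    (μ.prod μ) {p | pref (S.out p.1 p.2) n = w} ≤ (Fintype.card A : ENNReal)⁻¹ ^ n := by
  rcases Set.eq_empty_or_nonempty {p : (ℕ → A) × (ℕ → A) | pref (S.out p.1 p.2) n = w}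
    with h | ⟨⟨x, y⟩, rfl⟩
  · simp [h]
  calc _ ≤ (μ.prod μ) (cylinder (pref x (S.cfg x y n).2.1) ×ˢ
        cylinder (pref y (S.cfg x y n).2.2)) := by
        refine measure_mono fun p hp => ?_
        obtain ⟨-, hx, hy⟩ := S.cfg_eq_of_pref_out_eq hp
        exact ⟨mem_cylinder_pref_iff.2 hx, mem_cylinder_pref_iff.2 hy⟩
    _ = _ := by
        rw [Measure.prod_prod, hμ, hμ, ← pow_add, length_pref, length_pref, S.cfg_add]

theorem prod_pref_out_mem_le
    (hμ : ∀ w : List A, μ (cylinder w) = (Fintype.card A : ENNReal)⁻¹ ^ w.length)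
    (S : Shuffler A) (n : ℕ) (W : Finset (List A)) :
    (μ.prod μ) {p | pref (S.out p.1 p.2) n ∈ W} ≤
      W.card * (Fintype.card A : ENNReal)⁻¹ ^ n := by
  calc _ = (μ.prod μ) (⋃ w ∈ W, {p | pref (S.out p.1 p.2) n = w}) := by
        congr 1
        ext p
        simp
    _ ≤ ∑ w ∈ W, (μ.prod μ) {p | pref (S.out p.1 p.2) n = w} :=
        measure_biUnion_finset_le _ _
    _ ≤ ∑ w ∈ W, (Fintype.card A : ENNReal)⁻¹ ^ n :=
        Finset.sum_le_sum fun w _ => prod_pref_out_eq_le hμ S n w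
    _ = _ := by simp

end Shuffling

/-! ### Words drawn letter by letter from the uniform distribution -/

section Uniform

open MeasureTheory ProbabilityTheory

/-- The words carrying `γ` on the `q`-th of the consecutive blocks of length `γ.length`
starting at position `j`. -/
def blockSet [Inhabited A] (γ : List A) (j q : ℕ) : Set (ℕ → A) :=
  Set.pi (Finset.Ico (j + q * γ.length) (j + q * γ.length + γ.length))
    fun i => {γ.getD ((i - j) % γ.length) default}

theorem mem_blockSet_iff [Inhabited A] {γ : List A} {j q : ℕ} {x : ℕ → A} :
    x ∈ blockSet γ j q ↔
      ∀ s < γ.length, x (j + q * γ.length + s) = γ.getD s default := by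
  simp only [blockSet, Set.mem_pi, Finset.mem_coe, Finset.mem_Ico, Set.mem_singleton_iff]
  constructor
  · intro h s hs
    have := h (j + q * γ.length + s) ⟨by omega, by omega⟩
    rwa [show j + q * γ.length + s - j = s + q * γ.length by omega, Nat.add_mul_mod_self_right,
      Nat.mod_eq_of_lt hs] at this
  · rintro h i ⟨h₁, h₂⟩
    obtain ⟨s, rfl⟩ := Nat.exists_eq_add_of_le h₁
    rw [show j + q * γ.length + s - j = s + q * γ.length by omega, Nat.add_mul_mod_self_right,
      Nat.mod_eq_of_lt (by omega)]
    exact h s (by omega)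

theorem mem_blockSet_iff_take_drop [Inhabited A] {γ : List A} {j q n : ℕ} {x : ℕ → A}
    (h : j + q * γ.length + γ.length ≤ n) :
    x ∈ blockSet γ j q ↔ ((pref x n).drop (j + q * γ.length)).take γ.length = γ := by
  rw [mem_blockSet_iff, List.ext_getElem_iff]
  simp only [pref, List.length_take, List.length_drop, List.length_map, List.length_range,
    List.getElem_take, List.getElem_drop, List.getElem_map, List.getElem_range]
  constructor
  · intro H
    refine ⟨by omega, fun i _ hi => ?_⟩
    rw [H i hi, List.getD_eq_getElem _ _ hi]
  · rintro ⟨-, H⟩ s hs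
    rw [H s (by omega) hs, List.getD_eq_getElem _ _ hs]

theorem sum_range_eq_sum_residues {r : ℕ} (hr : 0 < r) (n : ℕ) (f : ℕ → ℝ) :
    ∑ i ∈ Finset.range (n + 1 - r), f i =
      ∑ j ∈ Finset.range r, ∑ q ∈ Finset.range ((n - j) / r), f (j + q * r) := by
  rw [← Finset.sum_fiberwise_of_maps_to (g := (· % r)) (t := Finset.range r)
    (fun i _ => Finset.mem_range.2 (Nat.mod_lt _ hr))]
  refine Finset.sum_congr rfl fun j hj => ?_
  have hj := Finset.mem_range.1 hj
  refine Finset.sum_nbij' (· / r) (fun q => j + q * r) ?_ ?_ ?_ ?_ ?_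
  · simp only [Finset.mem_filter, Finset.mem_range]
    rintro i ⟨hi, rfl⟩
    have := Nat.mod_add_div i r
    rw [Nat.lt_iff_add_one_le, Nat.le_div_iff_mul_le hr, add_mul, one_mul, mul_comm (i / r)]
    omega
  · simp only [Finset.mem_filter, Finset.mem_range]
    intro q hq
    rw [Nat.lt_iff_add_one_le, Nat.le_div_iff_mul_le hr, add_mul, one_mul] at hq
    exact ⟨by omega, by rw [Nat.add_mul_mod_self_right, Nat.mod_eq_of_lt hj]⟩
  · simp only [Finset.mem_filter, Finset.mem_range]
    rintro i ⟨hi, rfl⟩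
    rw [mul_comm, Nat.mod_add_div]
  · intro q _
    simp [Nat.add_mul_div_right _ _ hr, Nat.div_eq_of_lt hj]
  · simp only [Finset.mem_filter, Finset.mem_range]
    rintro i ⟨hi, rfl⟩
    rw [mul_comm, Nat.mod_add_div]

theorem occ_pref_eq_sum [Inhabited A] {γ : List A} (hγ : 0 < γ.length) (n : ℕ) (x : ℕ → A) :
    (occ (pref x n) γ : ℝ) = ∑ j ∈ Finset.range γ.length,
      ∑ q ∈ Finset.range ((n - j) / γ.length), (blockSet γ j q).indicator 1 x := by
  classical
  have h₁ : (occ (pref x n) γ : ℝ) = ∑ i ∈ Finset.range (n + 1 - γ.length),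
      if ((pref x n).drop i).take γ.length = γ then (1 : ℝ) else 0 := by
    rw [Finset.sum_boole, occ, Nat.card_coe_set_eq, ← Set.ncard_coe_finset]
    congr 2
    ext i
    simp only [length_pref, Set.mem_ofPred_eq, Finset.coe_filter, Finset.mem_range]
    refine and_congr_left fun _ => ?_
    omega
  rw [h₁, sum_range_eq_sum_residues hγ]
  refine Finset.sum_congr rfl fun j hj => Finset.sum_congr rfl fun q hq => ?_
  have hj := Finset.mem_range.1 hj
  have hq := Finset.mem_range.1 hq
  rw [Nat.lt_iff_add_one_le, Nat.le_div_iff_mul_le hγ, add_mul, one_mul] at hq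
  rw [Set.indicator_apply, Pi.one_apply]
  congr 1
  exact propext (mem_blockSet_iff_take_drop (by omega)).symm

variable [Inhabited A] [MeasurableSpace A] [MeasurableSingletonClass A]

theorem measurableSet_blockSet (γ : List A) (j q : ℕ) : MeasurableSet (blockSet γ j q) :=
  MeasurableSet.pi (Finset.countable_toSet _) fun _ _ => measurableSet_singleton _

variable [Fintype A]

/-- The uniform Bernoulli measure on infinite words. -/
noncomputable def unif (A : Type*) [Fintype A] [Inhabited A] [MeasurableSpace A] :
    Measure (ℕ → A) :=
  Measure.infinitePi fun _ => (PMF.uniformOfFintype A).toMeasure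

instance : IsProbabilityMeasure (unif A) := by
  unfold unif
  infer_instance

theorem unif_pi_singleton (s : Finset ℕ) (a : ℕ → A) :
    unif A (Set.pi s fun i => {a i}) = (Fintype.card A : ENNReal)⁻¹ ^ s.card := by
  rw [unif, Measure.infinitePi_pi _ fun _ _ => measurableSet_singleton _]
  simp only [PMF.toMeasure_apply_singleton _ _ (measurableSet_singleton _),
    PMF.uniformOfFintype_apply, Finset.prod_const]

theorem unif_pref_mem {n : ℕ} {W : Finset (List A)} (hW : ∀ w ∈ W, w.length = n) :
    unif A {x | pref x n ∈ W} = W.card * (Fintype.card A : ENNReal)⁻¹ ^ n := by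
  have hcyl : ∀ w ∈ W, {x : ℕ → A | pref x n = w} =
      Set.pi (Finset.range n) fun i => {w.getD i default} := by
    rintro w hw
    obtain rfl := hW w hw
    ext x
    simp only [pref, Set.mem_ofPred_eq, List.ext_getElem_iff, Set.mem_pi, Finset.mem_coe,
      Finset.mem_range, Set.mem_singleton_iff, List.length_map, List.length_range,
      List.getElem_map, List.getElem_range, true_and]
    refine forall_congr' fun i => ⟨fun h hi => ?_, fun h hi _ => ?_⟩
    · rw [h hi hi, List.getD_eq_getElem _ _ hi]
    · rw [h hi, List.getD_eq_getElem _ _ hi]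
  have hunion : {x : ℕ → A | pref x n ∈ W} = ⋃ w ∈ W, {x | pref x n = w} := by
    ext x
    simp
  rw [hunion, measure_biUnion_finset]
  · rw [Finset.sum_congr rfl fun w hw => by rw [hcyl w hw, unif_pi_singleton]]
    simp
  · intro v _ w _ hvw
    refine Set.disjoint_left.2 fun x hv hw => hvw ?_
    exact hv.symm.trans hw
  · intro w hw
    rw [hcyl w hw]
    exact MeasurableSet.pi (Finset.countable_toSet _) fun _ _ => measurableSet_singleton _

theorem unif_blockSet (γ : List A) (j q : ℕ) :
    unif A (blockSet γ j q) = (Fintype.card A : ENNReal)⁻¹ ^ γ.length := by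
  rw [blockSet, unif_pi_singleton]
  simp

theorem iIndepSet_blockSet (γ : List A) (j : ℕ) : iIndepSet (blockSet γ j) (unif A) := by
  rw [iIndepSet_iff_meas_biInter fun q => measurableSet_blockSet γ j q]
  intro s
  have hinter : (⋂ q ∈ s, blockSet γ j q) =
      Set.pi ((s.biUnion fun q =>
          Finset.Ico (j + q * γ.length) (j + q * γ.length + γ.length) : Finset ℕ))
        fun i => {γ.getD ((i - j) % γ.length) default} := by
    ext x
    simp only [blockSet, Set.mem_iInter, Set.mem_pi, Finset.mem_coe, Finset.mem_biUnion]
    exact ⟨fun h i ⟨q, hq, hi⟩ => h q hq i hi, fun h q hq i hi => h i ⟨q, hq, hi⟩⟩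
  have hdisj : ((s : Set ℕ)).PairwiseDisjoint fun q =>
      Finset.Ico (j + q * γ.length) (j + q * γ.length + γ.length) := by
    intro p _ q _ hpq
    refine Finset.disjoint_left.2 fun i hp hq => ?_
    simp only [Finset.mem_Ico] at hp hq
    rcases Nat.lt_or_gt_of_ne hpq with h | h
    · have := Nat.mul_le_mul_right γ.length (Nat.succ_le_of_lt h)
      rw [Nat.succ_mul] at this
      omega
    · have := Nat.mul_le_mul_right γ.length (Nat.succ_le_of_lt h)
      rw [Nat.succ_mul] at this
      omega
  rw [hinter, unif_pi_singleton, Finset.card_biUnion hdisj]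
  simp [unif_blockSet, ← pow_mul, mul_comm]

/-- Hoeffding's bound for the number of occurrences of `γ` in disjoint blocks. -/
theorem unif_sum_blockSet_le (γ : List A) (j : ℕ) {m : ℕ} {M δ : ℝ} (hm : m ≤ M) (hδ : 0 < δ) :
    (unif A).real {x | δ ≤ |∑ q ∈ Finset.range m, ((blockSet γ j q).indicator 1 x -
      (Fintype.card A : ℝ)⁻¹ ^ γ.length)|} ≤ 2 * Real.exp (-(2 * δ ^ 2 / M)) := by
  rcases Nat.eq_zero_or_pos m with rfl | hm₀
  · have : {x : ℕ → A | δ ≤ |∑ q ∈ Finset.range 0, ((blockSet γ j q).indicator 1 x -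
        (Fintype.card A : ℝ)⁻¹ ^ γ.length)|} = ∅ := by
      ext x
      simp [hδ]
    rw [this, measureReal_empty]
    positivity
  have hm₀' : (0 : ℝ) < m := by exact_mod_cast hm₀
  set p : ℝ := (Fintype.card A : ℝ)⁻¹ ^ γ.length with hp
  have hmeas (q : ℕ) : Measurable ((blockSet γ j q).indicator (1 : (ℕ → A) → ℝ)) :=
    measurable_one.indicator (measurableSet_blockSet γ j q)
  have hindep : iIndepFun (fun q x => (blockSet γ j q).indicator (1 : (ℕ → A) → ℝ) x - p)
      (unif A) :=
    ((iIndepSet_blockSet γ j).iIndepFun_indicator (β := ℝ)).comp (fun _ y => y - p)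
      fun _ => measurable_id.sub_const p
  have hint (q : ℕ) : ∫ x, (blockSet γ j q).indicator (1 : (ℕ → A) → ℝ) x ∂(unif A) = p := by
    rw [integral_indicator_one (measurableSet_blockSet γ j q), measureReal_def, unif_blockSet]
    simp [hp]
  have hsub (q : ℕ) : HasSubgaussianMGF
      (fun x => (blockSet γ j q).indicator (1 : (ℕ → A) → ℝ) x - p) (1 / 4) (unif A) := by
    have := hasSubgaussianMGF_of_mem_Icc (μ := unif A) (a := 0) (b := 1)
      (hmeas q).aemeasurable (Filter.Eventually.of_forall fun x => by
        by_cases hx : x ∈ blockSet γ j q <;> simp [hx])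
    rw [hint] at this
    convert this using 1
    ext
    norm_num
  have hexp : Real.exp (-δ ^ 2 / (2 * m * ((1 / 4 : NNReal) : ℝ))) ≤
      Real.exp (-(2 * δ ^ 2 / M)) := by
    rw [Real.exp_le_exp, neg_div, neg_le_neg_iff]
    calc 2 * δ ^ 2 / M ≤ 2 * δ ^ 2 / m := by gcongr
      _ = _ := by
        push_cast
        field_simp
        norm_num
  have h₁ := HasSubgaussianMGF.measure_sum_range_ge_le_of_iIndepFun hindep (n := m)
    (fun q _ => hsub q) hδ.le
  have h₂ := HasSubgaussianMGF.measure_sum_range_ge_le_of_iIndepFun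
    (X := fun q x => -((blockSet γ j q).indicator (1 : (ℕ → A) → ℝ) x - p))
    (hindep.comp (fun _ y => -y) fun _ => measurable_neg) (n := m)
    (fun q _ => (hsub q).neg) hδ.le
  calc _ ≤ (unif A).real ({x | δ ≤ ∑ q ∈ Finset.range m, ((blockSet γ j q).indicator 1 x - p)} ∪
        {x | δ ≤ ∑ q ∈ Finset.range m, -((blockSet γ j q).indicator 1 x - p)}) := by
        refine measureReal_mono fun x hx => ?_
        simp only [Set.mem_union, Set.mem_ofPred_eq, Finset.sum_neg_distrib] at hx ⊢
        exact le_abs.1 hx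
    _ ≤ _ := measureReal_union_le _ _
    _ ≤ _ := by
        rw [two_mul]
        exact add_le_add (h₁.trans hexp) (h₂.trans hexp)

theorem unif_occ_deviation_le (hA : 2 ≤ Fintype.card A) {γ : List A} (hγ : 0 < γ.length) {n : ℕ}
    (hn : γ.length ≤ n) {ε : ℝ} (hε : 2 ≤ ε * n) :
    (unif A).real {x | ε * n ≤
      |(occ (pref x n) γ : ℝ) - (n : ℝ) / (Fintype.card A : ℝ) ^ γ.length|} ≤
      γ.length * (2 * Real.exp (-(ε ^ 2 * n / (2 * γ.length)))) := by
  set p : ℝ := (Fintype.card A : ℝ)⁻¹ ^ γ.length with hp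
  set r := γ.length with hr
  have hr₀ : (0 : ℝ) < r := by exact_mod_cast hγ
  have hn₀ : (0 : ℝ) < n := hr₀.trans_le (by exact_mod_cast hn)
  have hp₀ : 0 ≤ p := by positivity
  have hrp : r * p ≤ 1 := by
    have h₁ : r ≤ Fintype.card A ^ r :=
      (Nat.lt_two_pow_self).le.trans (Nat.pow_le_pow_left hA r)
    have h₂ : (r : ℝ) ≤ (Fintype.card A : ℝ) ^ r := by exact_mod_cast h₁
    rw [hp, inv_pow, ← div_eq_mul_inv]
    exact div_le_one_of_le₀ h₂ (by positivity)
  have hdev (x : ℕ → A) : (occ (pref x n) γ : ℝ) - (n : ℝ) / (Fintype.card A : ℝ) ^ r =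
      (∑ j ∈ Finset.range r, ∑ q ∈ Finset.range ((n - j) / r),
        ((blockSet γ j q).indicator 1 x - p)) - (r - 1) * p := by
    have h := sum_range_eq_sum_residues hγ n fun _ => p
    simp only [Finset.sum_sub_distrib]
    rw [← h, ← occ_pref_eq_sum hγ, Finset.sum_const, Finset.card_range, nsmul_eq_mul,
      Nat.cast_sub (by omega), div_eq_mul_inv, ← inv_pow, ← hp]
    push_cast
    ring
  calc _ ≤ (unif A).real (⋃ j ∈ Finset.range r, {x | ε * n / (2 * r) ≤
        |∑ q ∈ Finset.range ((n - j) / r), ((blockSet γ j q).indicator 1 x - p)|}) := by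
        refine measureReal_mono (fun x hx => ?_) (measure_ne_top _ _)
        rw [Set.mem_ofPred_eq, hdev] at hx
        by_contra hcon
        simp only [Set.mem_iUnion, Set.mem_ofPred_eq, not_exists, not_le] at hcon
        have h₁ := Finset.abs_sum_le_sum_abs (fun j => ∑ q ∈ Finset.range ((n - j) / r),
          ((blockSet γ j q).indicator 1 x - p)) (Finset.range r)
        have h₂ := Finset.sum_lt_sum_of_nonempty (Finset.nonempty_range_iff.2 hγ.ne')
          fun j hj => hcon j hj
        rw [Finset.sum_const, Finset.card_range, nsmul_eq_mul,
          show (r : ℝ) * (ε * n / (2 * r)) = ε * n / 2 by field_simp] at h₂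
        have h₃ := abs_sub (∑ j ∈ Finset.range r, ∑ q ∈ Finset.range ((n - j) / r),
          ((blockSet γ j q).indicator 1 x - p)) ((r - 1) * p)
        have h₄ : |((r : ℝ) - 1) * p| ≤ 1 := by
          have : (1 : ℝ) ≤ r := by exact_mod_cast hγ
          rw [abs_of_nonneg (mul_nonneg (by linarith) hp₀)]
          nlinarith
        linarith
    _ ≤ ∑ j ∈ Finset.range r, (unif A).real {x | ε * n / (2 * r) ≤
        |∑ q ∈ Finset.range ((n - j) / r), ((blockSet γ j q).indicator 1 x - p)|} :=
        measureReal_biUnion_finset_le _ _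
    _ ≤ ∑ j ∈ Finset.range r, 2 * Real.exp (-(2 * (ε * n / (2 * r)) ^ 2 / (n / r))) := by
        refine Finset.sum_le_sum fun j _ => unif_sum_blockSet_le γ j ?_ (by positivity)
        refine Nat.cast_div_le.trans ?_
        gcongr
        omega
    _ = _ := by
        rw [Finset.sum_const, Finset.card_range, nsmul_eq_mul]
        congr 4
        field_simp

end Uniform

section Deviation

open MeasureTheory

variable [Fintype A] [MeasurableSpace A] {μ : Measure (ℕ → A)} [IsProbabilityMeasure μ]

theorem prod_compl_Eset_le (hA : 2 ≤ Fintype.card A)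
    (hμ : ∀ w : List A, μ (cylinder w) = (Fintype.card A : ENNReal)⁻¹ ^ w.length)
    (S : Shuffler A) {γ : List A} (hγ : 0 < γ.length) {n : ℕ} (hn : γ.length ≤ n) {ε : ℝ}
    (hε : 2 ≤ ε * n) :
    (μ.prod μ).real (Eset S ε γ n)ᶜ ≤
      γ.length * (2 * Real.exp (-(ε ^ 2 * n / (2 * γ.length)))) := by
  have : Nonempty A := Fintype.card_pos_iff.1 (by omega)
  inhabit A
  have hfin : {w : List A | w.length = n ∧
      ε * n ≤ |(occ w γ : ℝ) - (n : ℝ) / (Fintype.card A : ℝ) ^ γ.length|}.Finite :=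
    (List.finite_length_eq A n).subset fun w hw => hw.1
  let W := hfin.toFinset
  have hW : ∀ w ∈ W, w.length = n := fun w hw => (hfin.mem_toFinset.1 hw).1
  have hmem (x : ℕ → A) : pref x n ∈ W ↔ ε * n ≤
      |(occ (pref x n) γ : ℝ) - (n : ℝ) / (Fintype.card A : ℝ) ^ γ.length| := by
    simp [W]
  have hcompl : (Eset S ε γ n)ᶜ = {p | pref (S.out p.1 p.2) n ∈ W} := by
    ext p
    simp only [Eset, Set.mem_compl_iff, Set.mem_ofPred_eq, not_lt, hmem]
  have hcount : W.card * (Fintype.card A : ENNReal)⁻¹ ^ n ≤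
      ENNReal.ofReal (γ.length * (2 * Real.exp (-(ε ^ 2 * n / (2 * γ.length))))) := by
    let : MeasurableSpace A := ⊤
    rw [← unif_pref_mem hW]
    simp only [hmem]
    rw [← ofReal_measureReal]
    exact ENNReal.ofReal_le_ofReal (unif_occ_deviation_le hA hγ hn hε)
  rw [measureReal_def, hcompl]
  exact ENNReal.toReal_le_of_le_ofReal (by positivity)
    ((prod_pref_out_mem_le hμ S n W).trans hcount)

theorem prod_compl_Fset_le (hA : 2 ≤ Fintype.card A)
    (hμ : ∀ w : List A, μ (cylinder w) = (Fintype.card A : ENNReal)⁻¹ ^ w.length)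
    (S : ℕ → Shuffler A) (t : ℕ) {ℓ n : ℕ} (hn : ℓ ≤ n) {ε : ℝ} (hε : 2 ≤ ε * n) :
    (μ.prod μ).real (Fset S ε t ℓ n)ᶜ ≤
      t * ∑ r ∈ Finset.Icc 1 ℓ, (Fintype.card A : ℝ) ^ r *
        (r * (2 * Real.exp (-(ε ^ 2 * n / (2 * r))))) := by
  calc _ ≤ (μ.prod μ).real (⋃ i ∈ Finset.Icc 1 t, ⋃ r ∈ Finset.Icc 1 ℓ,
        ⋃ g : Fin r → A, (Eset (S i) ε (List.ofFn g) n)ᶜ) := by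
        refine measureReal_mono (fun p hp => ?_) (measure_ne_top _ _)
        by_contra hcon
        refine hp ?_
        simp only [Fset, Set.mem_iInter, Set.mem_ofPred_eq]
        rintro i hi r hr γ rfl
        by_contra hγ
        refine hcon ?_
        simp only [Set.mem_iUnion]
        exact ⟨i, hi, γ.length, hr, γ.get, by simpa using hγ⟩
    _ ≤ ∑ i ∈ Finset.Icc 1 t, ∑ r ∈ Finset.Icc 1 ℓ, ∑ g : Fin r → A,
        (μ.prod μ).real (Eset (S i) ε (List.ofFn g) n)ᶜ := by
        refine (measureReal_biUnion_finset_le _ _).trans (Finset.sum_le_sum fun i _ => ?_)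
        refine (measureReal_biUnion_finset_le _ _).trans (Finset.sum_le_sum fun r _ => ?_)
        exact measureReal_iUnion_fintype_le _
    _ ≤ ∑ i ∈ Finset.Icc 1 t, ∑ r ∈ Finset.Icc 1 ℓ, ∑ g : Fin r → A,
        (r * (2 * Real.exp (-(ε ^ 2 * n / (2 * r))))) := by
        refine Finset.sum_le_sum fun i _ => Finset.sum_le_sum fun r hr =>
          Finset.sum_le_sum fun g _ => ?_
        obtain ⟨h₁, h₂⟩ := Finset.mem_Icc.1 hr
        simpa using prod_compl_Eset_le hA hμ (S i) (γ := List.ofFn g) (by simpa using Nat.pos_of_ne_zero (by omega))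
          (by simpa using h₂.trans hn) hε
    _ = _ := by simp

end Deviation

theorem sum_pow_mul_self_lt {k ℓ : ℕ} (hk : 2 ≤ k) (hℓ : 0 < ℓ) :
    ∑ r ∈ Finset.Icc 1 ℓ, k ^ r * r < k ^ (3 * ℓ - 1) := by
  calc ∑ r ∈ Finset.Icc 1 ℓ, k ^ r * r ≤ ∑ r ∈ Finset.Icc 1 ℓ, k ^ (2 * r - 1) := by
        refine Finset.sum_le_sum fun r hr => ?_
        have h₁ := (Finset.mem_Icc.1 hr).1
        rw [show 2 * r - 1 = r + (r - 1) by omega, pow_add]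
        refine Nat.mul_le_mul_left _ ?_
        have h₂ : r - 1 < 2 ^ (r - 1) := Nat.lt_two_pow_self
        have h₃ := Nat.pow_le_pow_left hk (r - 1)
        omega
    _ = ∑ i ∈ (Finset.Icc 1 ℓ).image (fun r => 2 * r - 1), k ^ i := by
        rw [Finset.sum_image]
        intro a ha b hb hab
        simp only [Finset.coe_Icc, Set.mem_Icc] at ha hb hab
        omega
    _ < k ^ (2 * ℓ) := by
        refine Nat.geomSum_lt hk fun i hi => ?_
        simp only [Finset.mem_image, Finset.mem_Icc] at hi
        omega
    _ ≤ k ^ (3 * ℓ - 1) := Nat.pow_le_pow_right (by omega) (by omega)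

open MeasureTheory in
/-- Measure lower bound for the set `F(ε,t,ℓ,n)`. -/
theorem Fset_measure_bound {A : Type*} [Fintype A] [MeasurableSpace A]
    (hA : 2 ≤ Fintype.card A)
    (μ : Measure (ℕ → A)) [IsProbabilityMeasure μ]
    (hμ : ∀ w : List A, μ (cylinder w) = (Fintype.card A : ENNReal)⁻¹ ^ w.length)
    (S : ℕ → Shuffler A) (t ℓ n : ℕ) (ht : 0 < t) (hℓ : 0 < ℓ) (hn : 0 < n)
    (ε : ℝ) (hε₁ : 6 / ((n / ℓ : ℕ) : ℝ) ≤ ε)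
    (hε₂ : ε ≤ 1 / (Fintype.card A : ℝ) ^ ℓ) :
    1 - 2 * t * (Fintype.card A : ℝ) ^ (3 * ℓ - 1) *
        Real.exp (-(ε ^ 2 * n / (3 * ℓ)))
      < ((μ.prod μ) (Fset S ε t ℓ n)).toReal := by
  have hk : (2 : ℝ) ≤ Fintype.card A := by exact_mod_cast hA
  have ht' : (1 : ℝ) ≤ t := by exact_mod_cast ht
  have hℓ' : (0 : ℝ) < ℓ := by exact_mod_cast hℓ
  have hn' : (0 : ℝ) < n := by exact_mod_cast hn
  have hε₀ : 0 ≤ ε := le_trans (by positivity) hε₁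
  rcases lt_or_ge n ℓ with hnℓ | hnℓ
  · -- The lower bound is negative when `⌊n / ℓ⌋ = 0`.
    have hε : ε ≤ 1 := hε₂.trans (div_le_one_of_le₀ (one_le_pow₀ (by linarith)) (by positivity))
    have hx : ε ^ 2 * n / (3 * ℓ) ≤ 1 / 3 := by
      rw [div_le_div_iff₀ (by positivity) (by norm_num)]
      have h₁ : ε ^ 2 ≤ 1 := pow_le_one₀ hε₀ hε
      have h₂ : (n : ℝ) ≤ ℓ := by exact_mod_cast hnℓ.le
      nlinarith
    have hexp : 2 / 3 ≤ Real.exp (-(ε ^ 2 * n / (3 * ℓ))) := by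
      have := Real.add_one_le_exp (-(ε ^ 2 * n / (3 * ℓ)))
      linarith
    have hpow : (1 : ℝ) ≤ (Fintype.card A : ℝ) ^ (3 * ℓ - 1) := one_le_pow₀ (by linarith)
    have hprod : (2 : ℝ) * 1 * 1 * (2 / 3) ≤ 2 * t * (Fintype.card A : ℝ) ^ (3 * ℓ - 1) *
        Real.exp (-(ε ^ 2 * n / (3 * ℓ))) := by
      gcongr
    have : 0 ≤ ((μ.prod μ) (Fset S ε t ℓ n)).toReal := ENNReal.toReal_nonneg
    linarith
  have hεn : 2 ≤ ε * n := by
    have h₁ : 0 < n / ℓ := Nat.div_pos hnℓ hℓ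
    have h₂ : (0 : ℝ) < (n / ℓ : ℕ) := by exact_mod_cast h₁
    rw [div_le_iff₀ h₂] at hε₁
    have h₃ : ((n / ℓ : ℕ) : ℝ) ≤ n := by exact_mod_cast Nat.div_le_self n ℓ
    nlinarith
  have hF := prod_compl_Fset_le hA hμ S t hnℓ hεn
  have hsum : ∑ r ∈ Finset.Icc 1 ℓ, (Fintype.card A : ℝ) ^ r *
      (r * (2 * Real.exp (-(ε ^ 2 * n / (2 * r))))) ≤
      (∑ r ∈ Finset.Icc 1 ℓ, (Fintype.card A : ℝ) ^ r * r) *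
        (2 * Real.exp (-(ε ^ 2 * n / (3 * ℓ)))) := by
    rw [Finset.sum_mul]
    refine Finset.sum_le_sum fun r hr => ?_
    obtain ⟨h₁, h₂⟩ := Finset.mem_Icc.1 hr
    have h₁' : (0 : ℝ) < r := by exact_mod_cast h₁
    have h₂' : (r : ℝ) ≤ ℓ := by exact_mod_cast h₂
    rw [← mul_assoc]
    gcongr
    linarith
  have hpow : ∑ r ∈ Finset.Icc 1 ℓ, (Fintype.card A : ℝ) ^ r * r <
      (Fintype.card A : ℝ) ^ (3 * ℓ - 1) := by
    exact_mod_cast sum_pow_mul_self_lt hA hℓ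
  have hlt : (μ.prod μ).real (Fset S ε t ℓ n)ᶜ <
      2 * t * (Fintype.card A : ℝ) ^ (3 * ℓ - 1) * Real.exp (-(ε ^ 2 * n / (3 * ℓ))) := by
    calc _ ≤ _ := hF
      _ ≤ t * ((∑ r ∈ Finset.Icc 1 ℓ, (Fintype.card A : ℝ) ^ r * r) *
        (2 * Real.exp (-(ε ^ 2 * n / (3 * ℓ))))) := by gcongr
      _ < t * ((Fintype.card A : ℝ) ^ (3 * ℓ - 1) *
        (2 * Real.exp (-(ε ^ 2 * n / (3 * ℓ))))) := by gcongr
      _ = _ := by ring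
  have hunion := measureReal_union_le (μ := μ.prod μ) (Fset S ε t ℓ n) (Fset S ε t ℓ n)ᶜ
  rw [Set.union_compl_self, probReal_univ] at hunion
  rw [← measureReal_def]
  linarith

end FSI
end
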